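/- Let p be an odd prime with p ≡ 3 (mod 4). Then the quadratic Gauss sum G(1;p) = ∑_{b=0}^{p-1} e^{2πi b²/p} equals i√p. -/

import Mathlib

open Complex

/-- The Gaussian binomial coefficient evaluated at an element `q` of a commutative ring. -/
def gaussBinomial {R : Type*} [CommRing R] (q : R) : ℕ → ℕ → R
  | _, 0 => 1
  | 0, _ + 1 => 0
  | n + 1, k + 1 => gaussBinomial q n k + q ^ (k + 1) * gaussBinomial q n (k + 1)

section GaussBinomial

variable {R : Type*} [CommRing R] (q : R)

@[simp]
theorem gaussBinomial_zero_right (n : ℕ) : gaussBinomial q n 0 = 1 := by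
  cases n <;> rfl

theorem gaussBinomial_succ_succ (n k : ℕ) :
    gaussBinomial q (n + 1) (k + 1) =
      gaussBinomial q n k + q ^ (k + 1) * gaussBinomial q n (k + 1) := rfl

theorem gaussBinomial_eq_zero_of_lt : ∀ {n k : ℕ}, n < k → gaussBinomial q n k = 0
  | _, 0, h => absurd h (Nat.not_lt_zero _)
  | 0, _ + 1, _ => rfl
  | n + 1, k + 1, h => by
    rw [gaussBinomial_succ_succ, gaussBinomial_eq_zero_of_lt (by omega : n < k),
      gaussBinomial_eq_zero_of_lt (by omega : n < k + 1), mul_zero, add_zero]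

theorem gaussBinomial_succ_right_mul {n k : ℕ} (h : k ≤ n) :
    gaussBinomial q n (k + 1) * (1 - q ^ (k + 1)) =
      gaussBinomial q n k * (1 - q ^ (n - k)) := by
  induction n generalizing k with
  | zero =>
    obtain rfl : k = 0 := by omega
    simp [gaussBinomial]
  | succ n ih =>
    rcases k with _ | k
    · have h0 := ih (Nat.zero_le n)
      simp only [gaussBinomial_succ_succ, gaussBinomial_zero_right, Nat.sub_zero] at h0 ⊢
      linear_combination q ^ (0 + 1) * h0
    · have hk := ih (k := k) (by omega)
      rw [gaussBinomial_succ_succ, gaussBinomial_succ_succ, Nat.add_sub_add_right]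
      rcases Nat.lt_or_ge k n with hlt | hge
      · have hk' := ih (k := k + 1) hlt
        obtain ⟨d, rfl⟩ := Nat.exists_eq_add_of_lt hlt
        rw [show k + d + 1 - (k + 1) = d by omega] at hk'
        rw [show k + d + 1 - k = d + 1 by omega] at hk ⊢
        linear_combination q ^ (k + 1 + 1) * hk' + hk
      · obtain rfl : k = n := by omega
        simp [gaussBinomial_eq_zero_of_lt]

theorem gaussBinomial_succ_succ_mul (n k : ℕ) :
    gaussBinomial q (n + 1) (k + 1) * (1 - q ^ (k + 1)) =
      gaussBinomial q n k * (1 - q ^ (n + 1)) := by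
  rcases Nat.lt_or_ge n k with h | h
  · simp [gaussBinomial_eq_zero_of_lt, h]
  · have hk := gaussBinomial_succ_right_mul q h
    obtain ⟨d, rfl⟩ := Nat.exists_eq_add_of_le h
    rw [Nat.add_sub_cancel_left] at hk
    rw [gaussBinomial_succ_succ]
    linear_combination q ^ (k + 1) * hk

theorem alternating_sum_gaussBinomial_add_two (n : ℕ) :
    ∑ k ∈ Finset.range (n + 3), (-1) ^ k * gaussBinomial q (n + 2) k =
      (1 - q ^ (n + 1)) * ∑ k ∈ Finset.range (n + 1), (-1) ^ k * gaussBinomial q n k := by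
  have htel := Finset.sum_range_sub (fun k => (-1) ^ k * gaussBinomial q (n + 1) k) (n + 2)
  rw [gaussBinomial_eq_zero_of_lt q (by omega : n + 1 < n + 2)] at htel
  have hext : ∑ k ∈ Finset.range (n + 2), (-1) ^ k * gaussBinomial q n k =
      ∑ k ∈ Finset.range (n + 1), (-1) ^ k * gaussBinomial q n k := by
    rw [Finset.sum_range_succ, gaussBinomial_eq_zero_of_lt q (by omega : n < n + 1)]
    simp
  have hstep : ∀ k, (-1) ^ (k + 1) * gaussBinomial q (n + 2) (k + 1) =
      ((-1) ^ (k + 1) * gaussBinomial q (n + 1) (k + 1) -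
        (-1) ^ k * gaussBinomial q (n + 1) k) +
      (1 - q ^ (n + 1)) * ((-1) ^ k * gaussBinomial q n k) := fun k => by
    rw [gaussBinomial_succ_succ q (n + 1) k]
    linear_combination (-1) ^ k * gaussBinomial_succ_succ_mul q n k
  rw [Finset.sum_range_succ', Finset.sum_congr rfl fun k _ => hstep k,
    Finset.sum_add_distrib, htel, ← Finset.mul_sum, hext]
  simp

/-- Gauss's evaluation of the alternating sum of Gaussian binomial coefficients. -/
theorem alternating_sum_gaussBinomial_two_mul (m : ℕ) :
    ∑ k ∈ Finset.range (2 * m + 1), (-1) ^ k * gaussBinomial q (2 * m) k =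
      ∏ j ∈ Finset.range m, (1 - q ^ (2 * j + 1)) := by
  induction m with
  | zero => simp
  | succ m ih =>
    rw [Finset.prod_range_succ, ← ih, mul_comm (∑ _ ∈ _, _)]
    exact alternating_sum_gaussBinomial_add_two q (2 * m)

theorem IsPrimitiveRoot.gaussBinomial_eq [IsDomain R] {q w : R} {n : ℕ}
    (hq : IsPrimitiveRoot q (n + 1)) (hw : q * w ^ 2 = 1) {k : ℕ} (hk : k ≤ n) :
    gaussBinomial q n k = (-1) ^ k * w ^ (k * (k + 1)) := by
  induction k with
  | zero => simp
  | succ k ih =>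
    have hne : 1 - q ^ (k + 1) ≠ 0 :=
      sub_ne_zero.2 (hq.pow_ne_one_of_pos_of_lt k.succ_ne_zero (by omega)).symm
    have hqw : q ^ (k + 1) * w ^ (2 * (k + 1)) = 1 := by
      rw [pow_mul, ← mul_pow, hw, one_pow]
    have hqq : q ^ (n - k) * q ^ (k + 1) = 1 := by
      rw [← pow_add, show n - k + (k + 1) = n + 1 by omega, hq.pow_eq_one]
    have hinv : q ^ (n - k) = w ^ (2 * (k + 1)) := by
      linear_combination w ^ (2 * (k + 1)) * hqq - q ^ (n - k) * hqw
    have h := gaussBinomial_succ_right_mul q (by omega : k ≤ n)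
    rw [ih (by omega), hinv] at h
    refine mul_right_cancel₀ hne (h.trans ?_)
    rw [show (k + 1) * (k + 1 + 1) = k * (k + 1) + 2 * (k + 1) by ring, pow_add w]
    linear_combination -(-1) ^ k * w ^ (k * (k + 1)) * hqw

theorem IsPrimitiveRoot.sum_pow_mul_succ_eq_prod [IsDomain R] {q w : R} {m : ℕ}
    (hq : IsPrimitiveRoot q (2 * m + 1)) (hw : q * w ^ 2 = 1) :
    ∑ k ∈ Finset.range (2 * m + 1), w ^ (k * (k + 1)) =
      ∏ j ∈ Finset.range m, (1 - q ^ (2 * j + 1)) := by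
  rw [← alternating_sum_gaussBinomial_two_mul]
  refine Finset.sum_congr rfl fun k hk => ?_
  rw [hq.gaussBinomial_eq hw (Nat.lt_succ_iff.1 (Finset.mem_range.1 hk)), ← mul_assoc,
    ← mul_pow]
  simp

end GaussBinomial

theorem Function.Periodic.sum_range_add {M : Type*} [AddCommMonoid M] {f : ℕ → M} {n : ℕ}
    (hf : Function.Periodic f n) (h : ℕ) :
    ∑ k ∈ Finset.range n, f (k + h) = ∑ k ∈ Finset.range n, f k := by
  induction h with
  | zero => rfl
  | succ h ih =>
    rw [← ih]
    rcases n with _ | n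
    · simp
    · rw [Finset.sum_range_succ, Finset.sum_range_succ' (fun k => f (k + h))]
      congr 1
      · exact Finset.sum_congr rfl fun k _ => by congr 1; ring
      · rw [show n + (h + 1) = 0 + h + (n + 1) by ring, hf]

theorem sum_pow_sq_eq_pow_mul_sum {R : Type*} [CommRing R] {w : R} {m : ℕ}
    (hw : w ^ (2 * m + 1) = 1) :
    ∑ b ∈ Finset.range (2 * m + 1), w ^ (b ^ 2) =
      w ^ ((m + 1) ^ 2) * ∑ k ∈ Finset.range (2 * m + 1), w ^ (k * (k + 1)) := by
  have hper : Function.Periodic (fun b : ℕ => w ^ (b ^ 2)) (2 * m + 1) := fun b => by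
    simp only
    rw [show (b + (2 * m + 1)) ^ 2 = b ^ 2 + (2 * m + 1) * (2 * b + (2 * m + 1)) by ring,
      pow_add, pow_mul w (2 * m + 1), hw, one_pow, mul_one]
  rw [← hper.sum_range_add (m + 1), Finset.mul_sum]
  refine Finset.sum_congr rfl fun k _ => ?_
  rw [show (k + (m + 1)) ^ 2 = (m + 1) ^ 2 + k * (k + 1) + (2 * m + 1) * k by ring,
    pow_add, pow_mul w (2 * m + 1), hw, one_pow, mul_one, pow_add]

theorem sum_range_two_mul_add_one (m : ℕ) : ∑ j ∈ Finset.range m, (2 * j + 1) = m ^ 2 := by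
  induction m with
  | zero => rfl
  | succ m ih => rw [Finset.sum_range_succ, ih]; ring

theorem IsPrimitiveRoot.sum_pow_sq_eq_prod {K : Type*} [Field K] {w : K} {m : ℕ}
    (hw : IsPrimitiveRoot w (2 * m + 1)) :
    ∑ b ∈ Finset.range (2 * m + 1), w ^ (b ^ 2) =
      ∏ j ∈ Finset.range m, (w ^ (2 * j + 1) - w⁻¹ ^ (2 * j + 1)) := by
  have hw0 : w ≠ 0 := hw.ne_zero (by omega)
  have hq : IsPrimitiveRoot (w⁻¹ ^ 2) (2 * m + 1) :=
    hw.inv.pow_of_coprime 2 (by simp)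
  rw [sum_pow_sq_eq_pow_mul_sum hw.pow_eq_one,
    hq.sum_pow_mul_succ_eq_prod (w := w) (by field_simp)]
  have hfac : ∀ j, 1 - (w⁻¹ ^ 2) ^ (2 * j + 1) =
      w⁻¹ ^ (2 * j + 1) * (w ^ (2 * j + 1) - w⁻¹ ^ (2 * j + 1)) := fun j => by
    rw [mul_sub, ← mul_pow, inv_mul_cancel₀ hw0]
    ring
  rw [Finset.prod_congr rfl fun j _ => hfac j, Finset.prod_mul_distrib,
    Finset.prod_pow_eq_pow_sum, sum_range_two_mul_add_one, ← mul_assoc,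
    show (m + 1) ^ 2 = m ^ 2 + (2 * m + 1) by ring, pow_add, hw.pow_eq_one, mul_one,
    ← mul_pow, mul_inv_cancel₀ hw0, one_pow, one_mul]

theorem IsPrimitiveRoot.norm_sum_pow_sq {w : ℂ} {m : ℕ} (hw : IsPrimitiveRoot w (2 * m + 1)) :
    ‖∑ b ∈ Finset.range (2 * m + 1), w ^ (b ^ 2)‖ = Real.sqrt (2 * m + 1 : ℕ) := by
  have hw0 : w ≠ 0 := hw.ne_zero (by omega)
  have hw1 : ‖w‖ = 1 := hw.norm'_eq_one (by omega)
  have hq : IsPrimitiveRoot (w ^ 2) (2 * m + 1) := hw.pow_of_coprime 2 (by simp)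
  have hodd : ∀ j, ‖w ^ (2 * j + 1) - w⁻¹ ^ (2 * j + 1)‖ = ‖1 - (w ^ 2) ^ (2 * j + 1)‖ :=
    fun j => by
      rw [← one_mul ‖w ^ (2 * j + 1) - w⁻¹ ^ (2 * j + 1)‖, ← one_pow (2 * j + 1), ← hw1,
        ← norm_pow, ← norm_mul, mul_sub, ← mul_pow, ← mul_pow, mul_inv_cancel₀ hw0, one_pow,
        norm_sub_rev, ← sq]
  have heven : ∀ j ∈ Finset.range m, ‖1 - (w ^ 2) ^ (2 * (m - 1 - j) + 1)‖ =
      ‖1 - (w ^ 2) ^ (2 * j + 1 + 1)‖ := fun j hj => by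
    have hj := Finset.mem_range.1 hj
    have h1 : (w ^ 2) ^ (2 * (m - 1 - j) + 1) * (w ^ 2) ^ (2 * j + 1 + 1) = 1 := by
      rw [← pow_add, show 2 * (m - 1 - j) + 1 + (2 * j + 1 + 1) = 2 * m + 1 by omega,
        hq.pow_eq_one]
    have h2 : ‖(w ^ 2) ^ (2 * j + 1 + 1)‖ = 1 := by simp [hw1]
    rw [← mul_one ‖1 - (w ^ 2) ^ (2 * (m - 1 - j) + 1)‖, ← h2, ← norm_mul, sub_mul, h1,
      one_mul, norm_sub_rev]
  have hsplit : ∀ (f : ℕ → ℝ) (n : ℕ), ∏ k ∈ Finset.range (2 * n), f k =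
      (∏ j ∈ Finset.range n, f (2 * j)) * ∏ j ∈ Finset.range n, f (2 * j + 1) := fun f n => by
    induction n with
    | zero => simp
    | succ n ih =>
      rw [show 2 * (n + 1) = 2 * n + 1 + 1 by ring, Finset.prod_range_succ,
        Finset.prod_range_succ, ih, Finset.prod_range_succ, Finset.prod_range_succ]
      ring
  have hprod := congrArg norm hq.prod_one_sub_pow_eq_order
  rw [norm_prod, hsplit] at hprod
  rw [hw.sum_pow_sq_eq_prod, norm_prod, Finset.prod_congr rfl fun j _ => hodd j]
  symm
  rw [Real.sqrt_eq_iff_mul_self_eq (by positivity) (by positivity)]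
  nth_rewrite 2 [← Finset.prod_range_reflect]
  rw [Finset.prod_congr rfl heven, hprod]
  norm_cast

theorem sum_exp_sq_eq_I_mul_pos (t : ℕ) :
    ∃ c : ℝ, 0 < c ∧
      ∑ b ∈ Finset.range (2 * (2 * t + 1) + 1),
        exp (2 * Real.pi * I / (2 * (2 * t + 1) + 1 : ℕ)) ^ (b ^ 2) = I * c := by
  set n : ℕ := 2 * (2 * t + 1) + 1 with hn
  have hnR : (n : ℝ) = 4 * t + 3 := by rw [hn]; push_cast; ring
  have hn0 : (0 : ℝ) < n := by rw [hnR]; positivity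
  have hpi := Real.pi_pos
  let s : ℕ → ℝ := fun j => 2 * Real.sin (2 * Real.pi * (2 * j + 1) / n)
  have hfac : ∀ j : ℕ, exp (2 * Real.pi * I / n) ^ (2 * j + 1) -
      (exp (2 * Real.pi * I / n))⁻¹ ^ (2 * j + 1) = I * (s j : ℂ) := fun j => by
    have h := two_sin (2 * Real.pi * (2 * j + 1) / n)
    rw [← exp_neg, ← exp_nat_mul, ← exp_nat_mul]
    simp only [s]
    push_cast
    rw [h, mul_comm I (_ * I), mul_assoc _ I I, I_mul_I, mul_neg_one, neg_sub]
    congr 2 <;> ring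
  have hpos : ∀ j ∈ Finset.range (t + 1), 0 < s j := fun j hj => by
    have hj : (j : ℝ) ≤ t := by exact_mod_cast Nat.lt_succ_iff.1 (Finset.mem_range.1 hj)
    refine mul_pos two_pos (Real.sin_pos_of_pos_of_lt_pi (by positivity) ?_)
    rw [div_lt_iff₀ hn0, hnR]
    nlinarith
  have hneg : ∀ j ∈ Finset.range t, 0 < -s (t + 1 + j) := fun j hj => by
    have hj : (j : ℝ) + 1 ≤ t := by exact_mod_cast Finset.mem_range.1 hj
    have hsin : 0 < Real.sin (2 * Real.pi * (2 * (t + 1 + j : ℕ) + 1) / n - Real.pi) := by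
      apply Real.sin_pos_of_pos_of_lt_pi
      · rw [sub_pos, lt_div_iff₀ hn0, hnR]
        push_cast
        nlinarith [mul_nonneg hpi.le (Nat.cast_nonneg (α := ℝ) j)]
      · rw [sub_lt_iff_lt_add, div_lt_iff₀ hn0, hnR]
        push_cast
        nlinarith
    rw [Real.sin_sub_pi] at hsin
    simp only [s]
    linarith
  refine ⟨(∏ j ∈ Finset.range (t + 1), s j) * ∏ j ∈ Finset.range t, -s (t + 1 + j),
    mul_pos (Finset.prod_pos hpos) (Finset.prod_pos hneg), ?_⟩
  rw [(isPrimitiveRoot_exp n (by omega)).sum_pow_sq_eq_prod,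
    Finset.prod_congr rfl fun j _ => hfac j, Finset.prod_mul_distrib, Finset.prod_const,
    Finset.card_range, pow_succ, pow_mul, I_sq, show 2 * t + 1 = t + 1 + t by ring,
    Finset.prod_range_add, Finset.prod_neg, Finset.card_range]
  push_cast
  ring

theorem gauss_sum_three_mod_four (p : ℕ) (hp : p.Prime) (hp2 : p ≠ 2) (h4 : p % 4 = 3) :
    ∑ b ∈ Finset.range p, Complex.exp (2 * Real.pi * I * (b : ℂ) ^ 2 / p)
      = I * (Real.sqrt p : ℂ) := by
  obtain ⟨t, rfl⟩ : ∃ t, p = 2 * (2 * t + 1) + 1 := ⟨p / 4, by omega⟩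
  obtain ⟨c, hc, hsum⟩ := sum_exp_sq_eq_I_mul_pos t
  have hnorm := (isPrimitiveRoot_exp (2 * (2 * t + 1) + 1) (by omega)).norm_sum_pow_sq
  rw [hsum, norm_mul, norm_I, one_mul, norm_real, Real.norm_of_nonneg hc.le] at hnorm
  rw [← hnorm, ← hsum]
  refine Finset.sum_congr rfl fun b _ => ?_
  rw [← exp_nat_mul]
  congr 1
  push_cast
  ring
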